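/- arXiv:2408.14648 — 4 statements merged into one kernel-verified Lean document; each statement's English description precedes it below -/
import Mathlib

section
/- For every integer n ≥ 2 and every induced-2C2-saturated family F of subsets of [n], one has 2·|F| ≥ 3n + 1 (equivalently, |F| ≥ 3n/2 + 1/2). In particular the induced saturation number of 2C2 satisfies sat*(n, 2C2) ≥ 3n/2 + 1/2. -/
/-- `F ⊆ 𝒫([n])` contains an induced copy of the poset `2C₂`: four sets
`A ⊊ A'`, `B ⊊ B'`, with each of `A, A'` incomparable to each of `B, B'`. -/
def Contains2C2 {n : ℕ} (F : Finset (Finset (Fin n))) : Prop :=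
  ∃ A A' B B' : Finset (Fin n), A ∈ F ∧ A' ∈ F ∧ B ∈ F ∧ B' ∈ F ∧
    A ⊂ A' ∧ B ⊂ B' ∧
    ¬ A ⊆ B ∧ ¬ B ⊆ A ∧ ¬ A ⊆ B' ∧ ¬ B' ⊆ A ∧
    ¬ A' ⊆ B ∧ ¬ B ⊆ A' ∧ ¬ A' ⊆ B' ∧ ¬ B' ⊆ A'

/-- `F` is induced-`2C₂`-saturated: it is induced-`2C₂`-free, and adding any
missing set creates an induced copy of `2C₂`. -/
def Saturated2C2 {n : ℕ} (F : Finset (Finset (Fin n))) : Prop :=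
  ¬ Contains2C2 F ∧ ∀ S : Finset (Fin n), S ∉ F → Contains2C2 (insert S F)

/-- Adding a missing set `S` to a saturated family creates a copy of `2C₂` in which `S` forms
one pair with some `A ∈ F`, the other pair being `B ⊂ B'`. -/
theorem Saturated2C2.exists_witness {n : ℕ} {F : Finset (Finset (Fin n))} (hF : Saturated2C2 F)
    {S : Finset (Fin n)} (hS : S ∉ F) :
    ∃ A ∈ F, ∃ B ∈ F, ∃ B' ∈ F, B ⊂ B' ∧ (S ⊆ A ∨ A ⊆ S) ∧
      ¬ A ⊆ B' ∧ ¬ B ⊆ A ∧ ¬ S ⊆ B' ∧ ¬ B ⊆ S := by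
  obtain ⟨A, A', B, B', hA, hA', hB, hB', hAA, hBB, h1, h2, h3, h4, h5, h6, h7, h8⟩ := hF.2 S hS
  have ne : ∀ X Y : Finset (Fin n), ¬ X ⊆ Y → X ≠ Y := fun X Y h e => h e.subset
  have n1 := ne _ _ h1
  have n2 := ne _ _ h3
  have n3 := ne _ _ h5
  have n4 := ne _ _ h7
  have n5 := hAA.ne
  have n6 := hBB.ne
  rw [Finset.mem_insert] at hA hA' hB hB'
  rcases hA with rfl | hA
  · exact ⟨A', hA'.resolve_left n5.symm, B, hB.resolve_left n1.symm, B',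
      hB'.resolve_left n2.symm, hBB, Or.inl hAA.subset, h7, h6, h3, h2⟩
  rcases hA' with rfl | hA'
  · exact ⟨A, hA, B, hB.resolve_left n3.symm, B', hB'.resolve_left n4.symm, hBB,
      Or.inr hAA.subset, h3, h2, h7, h6⟩
  rcases hB with rfl | hB
  · exact ⟨B', hB'.resolve_left n6.symm, A, hA, A', hA', hAA, Or.inl hBB.subset,
      h8, h3, h6, h1⟩
  rcases hB' with rfl | hB'
  · exact ⟨B, hB, A, hA, A', hA', hAA, Or.inr hBB.subset, h6, h1, h8, h3⟩
  · exact (hF.1 ⟨A, A', B, B', hA, hA', hB, hB', hAA, hBB, h1, h2, h3, h4, h5, h6, h7, h8⟩).elim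

/-- The union of all members of `F` strictly below `B`. -/
def strictLowerUnion {n : ℕ} (F : Finset (Finset (Fin n))) (B : Finset (Fin n)) :
    Finset (Fin n) :=
  (F.filter (· ⊂ B)).sup id

theorem strictLowerUnion_subset {n : ℕ} (F : Finset (Finset (Fin n))) (B : Finset (Fin n)) :
    strictLowerUnion F B ⊆ B :=
  Finset.sup_le fun _ hX => (Finset.mem_filter.1 hX).2.subset

theorem subset_strictLowerUnion {n : ℕ} {F : Finset (Finset (Fin n))} {A B : Finset (Fin n)}
    (hA : A ∈ F) (h : A ⊂ B) : A ⊆ strictLowerUnion F B :=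
  Finset.le_sup (f := id) (Finset.mem_filter.2 ⟨hA, h⟩)

/-- In a `2C₂`-free family the strict down-sets are nested, hence so are their unions. -/
theorem strictLowerUnion_total {n : ℕ} {F : Finset (Finset (Fin n))} (hF : ¬ Contains2C2 F)
    {X Y : Finset (Fin n)} (hX : X ∈ F) (hY : Y ∈ F) :
    strictLowerUnion F X ⊆ strictLowerUnion F Y ∨
      strictLowerUnion F Y ⊆ strictLowerUnion F X := by
  suffices h : F.filter (· ⊂ X) ⊆ F.filter (· ⊂ Y) ∨ F.filter (· ⊂ Y) ⊆ F.filter (· ⊂ X) from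
    h.imp (fun h => Finset.sup_mono h) (fun h => Finset.sup_mono h)
  by_contra! h
  obtain ⟨A, hA, hAY⟩ := Finset.not_subset.1 h.1
  obtain ⟨B, hB, hBX⟩ := Finset.not_subset.1 h.2
  rw [Finset.mem_filter] at hA hB hAY hBX
  have hAY : ¬ A ⊂ Y := fun h => hAY ⟨hA.1, h⟩
  have hBX : ¬ B ⊂ X := fun h => hBX ⟨hB.1, h⟩
  have hAX := hA.2
  have hBY := hB.2
  exact hF ⟨A, X, B, Y, hA.1, hX, hB.1, hY, hAX, hBY,
    fun h => hAY (lt_of_le_of_lt h hBY), fun h => hBX (lt_of_le_of_lt h hAX),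
    fun h => (eq_or_lt_of_le h).elim
      (fun e => hBX (hBY.trans (e ▸ hAX))) (fun h => hAY h),
    fun h => hBX (hBY.trans (lt_of_le_of_lt h hAX)),
    fun h => hAY (hAX.trans (lt_of_le_of_lt h hBY)),
    fun h => (eq_or_lt_of_le h).elim
      (fun e => hAY (hAX.trans (e ▸ hBY))) (fun h => hBX h),
    fun h => hAY (lt_of_lt_of_le hAX h),
    fun h => hBX (lt_of_lt_of_le hBY h)⟩

/-- A set comparable to every `strictLowerUnion F B` belongs to the saturated family `F`. -/
theorem Saturated2C2.mem_of_comparable {n : ℕ} {F : Finset (Finset (Fin n))}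
    (hF : Saturated2C2 F) {S : Finset (Fin n)}
    (hS : ∀ B ∈ F, strictLowerUnion F B ⊆ S ∨ S ⊆ strictLowerUnion F B) : S ∈ F := by
  by_contra h
  obtain ⟨A, -, B, hB, B', hB', hBB, -, -, -, h1, h2⟩ := hF.exists_witness h
  rcases hS B' hB' with h | h
  · exact h2 ((subset_strictLowerUnion hB hBB).trans h)
  · exact h1 (h.trans (strictLowerUnion_subset F B'))

/-- A set comparable to all members of a chain can be enlarged by one point, staying comparable
to all of them. -/
theorem exists_insert_comparable {α : Type*} [DecidableEq α] [Fintype α]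
    (T : Finset (Finset α)) (hT : ∀ X ∈ T, ∀ Y ∈ T, X ⊆ Y ∨ Y ⊆ X) (S : Finset α)
    (hS : ∀ X ∈ T, X ⊆ S ∨ S ⊆ X) (hne : S ≠ Finset.univ) :
    ∃ x ∉ S, ∀ X ∈ T, X ⊆ insert x S ∨ insert x S ⊆ X := by
  by_cases hU : (T.filter (S ⊂ ·)).Nonempty
  · obtain ⟨D, hD, hmin⟩ := Finset.exists_min_image _ Finset.card hU
    rw [Finset.mem_filter] at hD
    obtain ⟨x, hxD, hxS⟩ := Finset.exists_of_ssubset hD.2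
    refine ⟨x, hxS, fun X hX => ?_⟩
    by_cases hSX : S ⊂ X
    · right
      have hDX : D ⊆ X := by
        rcases hT D hD.1 X hX with h | h
        · exact h
        · exact (Finset.eq_of_subset_of_card_le h
            (hmin X (Finset.mem_filter.2 ⟨hX, hSX⟩))).ge
      exact Finset.insert_subset (hDX hxD) hSX.subset
    · left
      have hXS : X ⊆ S := (hS X hX).elim id fun h => by
        by_contra h'
        exact hSX ⟨h, h'⟩
      exact hXS.trans (Finset.subset_insert x S)
  · obtain ⟨x, hx⟩ : ∃ x, x ∉ S := by
      by_contra! h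
      exact hne (Finset.eq_univ_iff_forall.2 h)
    refine ⟨x, hx, fun X hX => Or.inl ?_⟩
    have hXS : X ⊆ S := (hS X hX).elim id fun h => by
      by_contra h'
      exact hU ⟨X, Finset.mem_filter.2 ⟨hX, h, h'⟩⟩
    exact hXS.trans (Finset.subset_insert x S)

/-- Every chain of finsets in `α` extends to a full chain `c 0 ⊆ c 1 ⊆ ⋯`. -/
theorem exists_full_chain {α : Type*} [DecidableEq α] [Fintype α]
    (T : Finset (Finset α)) (hT : ∀ X ∈ T, ∀ Y ∈ T, X ⊆ Y ∨ Y ⊆ X) :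
    ∃ c : ℕ → Finset α, Monotone c ∧ (∀ i ≤ Fintype.card α, (c i).card = i) ∧
      (∀ i, ∀ X ∈ T, X ⊆ c i ∨ c i ⊆ X) ∧ ∀ X ∈ T, ∃ i, c i = X := by
  have step : ∀ S : {S : Finset α // ∀ X ∈ T, X ⊆ S ∨ S ⊆ X},
      ∃ S' : {S : Finset α // ∀ X ∈ T, X ⊆ S ∨ S ⊆ X}, S.1 ⊆ S'.1 ∧
        (S.1 ≠ Finset.univ → S'.1.card = S.1.card + 1) := by
    rintro ⟨S, hS⟩
    by_cases hne : S = Finset.univ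
    · exact ⟨⟨S, hS⟩, subset_rfl, fun h => (h hne).elim⟩
    · obtain ⟨x, hx, h⟩ := exists_insert_comparable T hT S hS hne
      exact ⟨⟨insert x S, h⟩, Finset.subset_insert x S,
        fun _ => Finset.card_insert_of_notMem hx⟩
  choose f hf hcard using step
  let g : ℕ → {S : Finset α // ∀ X ∈ T, X ⊆ S ∨ S ⊆ X} := fun i =>
    f^[i] ⟨∅, fun X _ => Or.inr (Finset.empty_subset X)⟩
  have hg : ∀ i, g (i + 1) = f (g i) := fun i => Function.iterate_succ_apply' f i _
  have hc : ∀ i ≤ Fintype.card α, (g i).1.card = i := by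
    intro i
    induction i with
    | zero => intro _; rfl
    | succ i ih =>
      intro hi
      have hi' := ih (by omega)
      rw [hg, hcard _ (fun h => ?_), hi']
      rw [h, Finset.card_univ] at hi'
      omega
  refine ⟨fun i => (g i).1, monotone_nat_of_le_succ fun i => ?_, hc, fun i => (g i).2,
    fun X hX => ⟨X.card, ?_⟩⟩
  · simp only [hg]
    exact hf (g i)
  · have hk := hc X.card (Finset.card_le_univ X)
    rcases (g X.card).2 X hX with h | h
    · exact (Finset.eq_of_subset_of_card_le h hk.le).symm
    · exact Finset.eq_of_subset_of_card_le h hk.ge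

/-- A saturated family contains a full chain of `𝒫([n])` that separates all of its strict
inclusions. -/
theorem Saturated2C2.exists_separating_chain {n : ℕ} {F : Finset (Finset (Fin n))}
    (hF : Saturated2C2 F) :
    ∃ c : ℕ → Finset (Fin n), Monotone c ∧ (∀ i ≤ n, (c i).card = i) ∧ (∀ i, c i ∈ F) ∧
      ∀ A ∈ F, ∀ B ∈ F, A ⊂ B → ∃ i, A ⊆ c i ∧ c i ⊆ B := by
  obtain ⟨c, hmono, hcard, hcomp, hsurj⟩ := exists_full_chain (F.image (strictLowerUnion F)) (by
    simp only [Finset.forall_mem_image]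
    exact fun X hX Y hY => strictLowerUnion_total hF.1 hX hY)
  simp only [Finset.forall_mem_image, Fintype.card_fin] at hcard hcomp hsurj
  refine ⟨c, hmono, hcard, fun i => hF.mem_of_comparable fun B hB => hcomp i hB, ?_⟩
  intro A hA B hB hAB
  obtain ⟨i, hi⟩ := hsurj hB
  exact ⟨i, hi ▸ subset_strictLowerUnion hA hAB, hi ▸ strictLowerUnion_subset F B⟩

/-- Each inner member `c (i + 1)` of a separating full chain is incomparable to some `X ∈ F`
that either contains `c i` or is contained in `c (i + 2)`. -/
theorem Saturated2C2.exists_incomparable {n : ℕ} {F : Finset (Finset (Fin n))}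
    (hF : Saturated2C2 F) {c : ℕ → Finset (Fin n)} (hmono : Monotone c)
    (hsep : ∀ A ∈ F, ∀ B ∈ F, A ⊂ B → ∃ i, A ⊆ c i ∧ c i ⊆ B) {i : ℕ}
    (h₁ : c i ⊂ c (i + 1)) (h₂ : c (i + 1) ⊂ c (i + 2)) :
    ∃ X ∈ F, ¬ c (i + 1) ⊆ X ∧ ¬ X ⊆ c (i + 1) ∧ (c i ⊆ X ∨ X ⊆ c (i + 2)) := by
  obtain ⟨z, hz, hz'⟩ := Finset.exists_of_ssubset h₁
  obtain ⟨y, hy, hy'⟩ := Finset.exists_of_ssubset h₂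
  set S := insert y (c i) with hS
  have hiS : c i ⊆ S := Finset.subset_insert y (c i)
  have hSi : S ⊆ c (i + 2) := Finset.insert_subset hy (h₁.trans h₂).subset
  by_cases hSF : S ∈ F
  · refine ⟨S, hSF, fun h => ?_, fun h => hy' (h (Finset.mem_insert_self y _)), Or.inl hiS⟩
    rcases Finset.mem_insert.1 (h hz) with rfl | h
    · exact hy' hz
    · exact hz' h
  · obtain ⟨A, hA, B, hB, B', hB', hBB, hSA, hAB', hBA, hSB', hBS⟩ := hF.exists_witness hSF
    obtain ⟨t, hBt, htB⟩ := hsep B hB B' hB' hBB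
    have ht : t = i + 1 := by
      rcases lt_trichotomy t (i + 1) with h | h | h
      · exact (hBS (hBt.trans ((hmono (by omega)).trans hiS))).elim
      · exact h
      · exact (hSB' (hSi.trans ((hmono (by omega)).trans htB))).elim
    subst ht
    exact ⟨A, hA, fun h => hBA (hBt.trans h), fun h => hAB' (h.trans htB),
      hSA.imp hiS.trans fun h => h.trans hSi⟩

/-- For every `n ≥ 2`, every induced-`2C₂`-saturated family `F ⊆ 𝒫([n])`
satisfies `2|F| ≥ 3n + 1`, i.e. `|F| ≥ 3n/2 + 1/2`. -/
theorem lower_bound_3n_over_2 (n : ℕ) (hn : 2 ≤ n)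
    (F : Finset (Finset (Fin n))) (hF : Saturated2C2 F) :
    3 * n + 1 ≤ 2 * F.card := by
  obtain ⟨c, hmono, hcard, hcF, hsep⟩ := hF.exists_separating_chain
  have hss : ∀ i < n, c i ⊂ c (i + 1) := fun i hi =>
    Finset.ssubset_iff_subset_ne.2 ⟨hmono (Nat.le_succ i), fun h => by
      have h₁ := hcard i (by omega)
      have h₂ := hcard (i + 1) (by omega)
      rw [h] at h₁
      omega⟩
  set C := (Finset.range (n + 1)).image c with hC
  have hCF : C ⊆ F := Finset.image_subset_iff.2 fun i _ => hcF i
  have hCcard : C.card = n + 1 := by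
    rw [hC, Finset.card_image_of_injOn, Finset.card_range]
    intro i hi j hj hij
    simp only [Finset.coe_range, Set.mem_Iio] at hi hj
    rw [← hcard i (by omega), ← hcard j (by omega), hij]
  have hcount : (Finset.range (n - 1)).card ≤
      ((F \ C) ×ˢ (Finset.univ : Finset Bool)).card := by
    refine Finset.card_le_card_of_forall_subsingleton
      (fun i p => if p.2 then c i ⊆ p.1 ∧ ¬ c (i + 1) ⊆ p.1
        else p.1 ⊆ c (i + 2) ∧ ¬ p.1 ⊆ c (i + 1)) ?_ ?_
    · intro i hi
      rw [Finset.mem_range] at hi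
      obtain ⟨X, hX, h₁, h₂, h⟩ := hF.exists_incomparable hmono hsep
        (hss i (by omega)) (hss (i + 1) (by omega))
      have hXC : X ∈ F \ C := by
        refine Finset.mem_sdiff.2 ⟨hX, fun hXC => ?_⟩
        obtain ⟨j, -, rfl⟩ := Finset.mem_image.1 hXC
        exact (le_total (i + 1) j).elim (fun h => h₁ (hmono h)) (fun h => h₂ (hmono h))
      rcases h with h | h
      · exact ⟨(X, true), by simp [-Finset.mem_sdiff, hXC], by simp [h, h₁]⟩
      · exact ⟨(X, false), by simp [-Finset.mem_sdiff, hXC], by simp [h, h₂]⟩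
    · rintro ⟨X, b⟩ - i ⟨-, hi⟩ j ⟨-, hj⟩
      cases b
      · simp only [Bool.false_eq_true, if_false] at hi hj
        rcases lt_trichotomy i j with h | h | h
        · exact (hj.2 (hi.1.trans (hmono (by omega)))).elim
        · exact h
        · exact (hi.2 (hj.1.trans (hmono (by omega)))).elim
      · simp only [if_true] at hi hj
        rcases lt_trichotomy i j with h | h | h
        · exact (hi.2 ((hmono (by omega)).trans hj.1)).elim
        · exact h
        · exact (hj.2 ((hmono (by omega)).trans hi.1)).elim
  rw [Finset.card_range, Finset.card_product, Finset.card_univ, Fintype.card_bool] at hcount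
  have hadd := Finset.card_sdiff_add_card_eq_card hCF
  omega
end

section
/- For every integer n ≥ 2 and every induced-2C2-saturated family F of subsets of [n], one has |F| ≥ n + 2. -/
/-- The members of `F` strictly below `A`. -/
def strictlyBelow {n : ℕ} (F : Finset (Finset (Fin n))) (A : Finset (Fin n)) :
    Finset (Finset (Fin n)) :=
  F.filter (· ⊂ A)

/-- The union of the members of `F` strictly below `A`. -/
def unionBelow {n : ℕ} (F : Finset (Finset (Fin n))) (A : Finset (Fin n)) : Finset (Fin n) :=
  (strictlyBelow F A).sup id

section

variable {n : ℕ} {F : Finset (Finset (Fin n))}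

lemma mem_strictlyBelow {A X : Finset (Fin n)} : X ∈ strictlyBelow F A ↔ X ∈ F ∧ X ⊂ A := by
  simp [strictlyBelow]

lemma subset_unionBelow {A X : Finset (Fin n)} (h : X ∈ strictlyBelow F A) :
    X ⊆ unionBelow F A :=
  Finset.le_sup (f := id) h

lemma unionBelow_subset (A : Finset (Fin n)) : unionBelow F A ⊆ A :=
  Finset.sup_le fun _ hX => (mem_strictlyBelow.1 hX).2.subset

lemma unionBelow_mono {A B : Finset (Fin n)} (h : strictlyBelow F A ⊆ strictlyBelow F B) :
    unionBelow F A ⊆ unionBelow F B :=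
  Finset.sup_mono h

/-- A `2C₂`-free family is an interval order: its strict down-sets form a chain. -/
lemma strictlyBelow_total (hF : ¬ Contains2C2 F) {A B : Finset (Fin n)} (hA : A ∈ F)
    (hB : B ∈ F) :
    strictlyBelow F A ⊆ strictlyBelow F B ∨ strictlyBelow F B ⊆ strictlyBelow F A := by
  by_contra! h
  obtain ⟨X, hX, hX'⟩ := Finset.not_subset.1 h.1
  obtain ⟨Y, hY, hY'⟩ := Finset.not_subset.1 h.2
  rw [mem_strictlyBelow] at hX hX' hY hY'
  have hXB : ¬ X ⊂ B := fun h => hX' ⟨hX.1, h⟩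
  have hYA : ¬ Y ⊂ A := fun h => hY' ⟨hY.1, h⟩
  have hXY : ¬ X ⊆ Y := fun h => hXB (h.trans_ssubset hY.2)
  have hYX : ¬ Y ⊆ X := fun h => hYA (h.trans_ssubset hX.2)
  exact hF ⟨X, A, Y, B, hX.1, hA, hY.1, hB, hX.2, hY.2, hXY, hYX,
    fun h => h.eq_or_ssubset.elim (fun e => hYX (e ▸ hY.2.subset)) hXB,
    fun h => hYX (hY.2.subset.trans h),
    fun h => hXY (hX.2.subset.trans h),
    fun h => h.eq_or_ssubset.elim (fun e => hXY (e ▸ hX.2.subset)) hYA,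
    fun h => hXB (hX.2.trans_subset h),
    fun h => hYA (hY.2.trans_subset h)⟩

lemma Saturated2C2.exists_chain_of_notMem (hF : Saturated2C2 F) {S : Finset (Fin n)}
    (hS : S ∉ F) : ∃ B ∈ F, ∃ B' ∈ F, B ⊂ B' ∧ ¬ S ⊆ B' ∧ ¬ B ⊆ S := by
  obtain ⟨A, A', B, B', hA, hA', hB, hB', hAA, hBB, h1, h2, h3, h4, h5, h6, h7, h8⟩ := hF.2 S hS
  have key : ∀ {X : Finset (Fin n)}, X ∈ insert S F → X ≠ S → X ∈ F :=
    fun h hne => (Finset.mem_insert.1 h).resolve_left hne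
  by_cases eA : A = S
  · subst eA
    exact ⟨B, key hB fun e => h2 e.subset, B', key hB' fun e => h4 e.subset, hBB, h3, h2⟩
  by_cases eA' : A' = S
  · subst eA'
    exact ⟨B, key hB fun e => h6 e.subset, B', key hB' fun e => h8 e.subset, hBB, h7, h6⟩
  by_cases eB : B = S
  · subst eB
    exact ⟨A, key hA eA, A', key hA' eA', hAA, h6, h1⟩
  by_cases eB' : B' = S
  · subst eB'
    exact ⟨A, key hA eA, A', key hA' eA', hAA, h8, h3⟩
  exact absurd ⟨A, A', B, B', key hA eA, key hA' eA', key hB eB, key hB' eB', hAA, hBB,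
    h1, h2, h3, h4, h5, h6, h7, h8⟩ hF.1

lemma Saturated2C2.empty_mem (hF : Saturated2C2 F) : ∅ ∈ F := by
  by_contra h
  obtain ⟨B, -, B', -, -, h, -⟩ := hF.exists_chain_of_notMem h
  exact h (Finset.empty_subset _)

lemma Saturated2C2.univ_mem (hF : Saturated2C2 F) : Finset.univ ∈ F := by
  by_contra h
  obtain ⟨B, -, B', -, -, -, h⟩ := hF.exists_chain_of_notMem h
  exact h (Finset.subset_univ _)

lemma Saturated2C2.unionBelow_mem (hF : Saturated2C2 F) {A : Finset (Fin n)} (hA : A ∈ F) :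
    unionBelow F A ∈ F := by
  by_contra h
  obtain ⟨B, hB, B', hB', hBB, h1, h2⟩ := hF.exists_chain_of_notMem h
  rcases strictlyBelow_total hF.1 hA hB' with h | h
  · exact h1 ((unionBelow_mono h).trans (unionBelow_subset _))
  · exact h2 (subset_unionBelow (h (mem_strictlyBelow.2 ⟨hB, hBB⟩)))

/-- Among the strict down-sets whose union misses `i`, there is a largest one. -/
lemma Saturated2C2.exists_last_avoiding (hF : Saturated2C2 F) (i : Fin n) :
    ∃ A ∈ F, i ∉ unionBelow F A ∧
      ∀ B ∈ F, i ∉ unionBelow F B → strictlyBelow F B ⊆ strictlyBelow F A := by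
  obtain ⟨A, hA, hmax⟩ := Finset.exists_max_image (F.filter fun A => i ∉ unionBelow F A)
    (fun A => (strictlyBelow F A).card)
    ⟨∅, Finset.mem_filter.2 ⟨hF.empty_mem, fun h => by simpa using unionBelow_subset _ h⟩⟩
  rw [Finset.mem_filter] at hA
  refine ⟨A, hA.1, hA.2, fun B hB hi => ?_⟩
  rcases strictlyBelow_total hF.1 hB hA.1 with h | h
  · exact h
  · exact (Finset.eq_of_subset_of_card_le h (hmax B (Finset.mem_filter.2 ⟨hB, hi⟩))).ge

lemma Saturated2C2.insert_unionBelow_mem (hF : Saturated2C2 F) {i : Fin n}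
    {A : Finset (Fin n)} (hA : A ∈ F)
    (hmax : ∀ B ∈ F, i ∉ unionBelow F B → strictlyBelow F B ⊆ strictlyBelow F A) :
    insert i (unionBelow F A) ∈ F := by
  by_contra h
  obtain ⟨B, hB, B', hB', hBB, h1, h2⟩ := hF.exists_chain_of_notMem h
  have hBA : B ∉ strictlyBelow F A := fun h =>
    h2 ((subset_unionBelow h).trans (Finset.subset_insert _ _))
  have hBB' : B ∈ strictlyBelow F B' := mem_strictlyBelow.2 ⟨hB, hBB⟩
  have hi : i ∈ unionBelow F B' := by
    by_contra hi
    exact hBA (hmax B' hB' hi hBB')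
  have hAB : strictlyBelow F A ⊆ strictlyBelow F B' :=
    (strictlyBelow_total hF.1 hA hB').resolve_right fun h => hBA (h hBB')
  exact h1 ((Finset.insert_subset hi (unionBelow_mono hAB)).trans (unionBelow_subset _))

/-- The least union of a strict down-set containing `i`, or `univ` if there is none. -/
lemma Saturated2C2.exists_first_containing (hF : Saturated2C2 F) (i : Fin n) :
    ∃ T ∈ F, i ∈ T ∧ (∀ A ∈ F, i ∈ unionBelow F A → T ⊆ unionBelow F A) ∧
      (T = Finset.univ ∨ ∃ B ∈ F, T = unionBelow F B) := by
  by_cases hne : (F.filter fun A => i ∈ unionBelow F A).Nonempty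
  · obtain ⟨B, hB, hmin⟩ := Finset.exists_min_image _ (fun A => (strictlyBelow F A).card) hne
    rw [Finset.mem_filter] at hB
    refine ⟨_, hF.unionBelow_mem hB.1, hB.2, fun A hA hi => unionBelow_mono ?_,
      Or.inr ⟨B, hB.1, rfl⟩⟩
    rcases strictlyBelow_total hF.1 hB.1 hA with h | h
    · exact h
    · exact (Finset.eq_of_subset_of_card_le h (hmin A (Finset.mem_filter.2 ⟨hA, hi⟩))).ge
  · exact ⟨_, hF.univ_mem, Finset.mem_univ _,
      fun A hA hi => absurd ⟨A, Finset.mem_filter.2 ⟨hA, hi⟩⟩ hne, Or.inl rfl⟩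

lemma Saturated2C2.exists_incomparable_s3 (hF : Saturated2C2 F) (hn : 2 ≤ n) :
    ∃ A ∈ F, ∃ B ∈ F, ¬ A ⊆ B ∧ ¬ B ⊆ A := by
  by_cases h : ∀ i : Fin n, {i} ∈ F
  · exact ⟨_, h ⟨0, by omega⟩, _, h ⟨1, by omega⟩, by simp, by simp⟩
  push Not at h
  obtain ⟨i, hi⟩ := h
  obtain ⟨A, A', B, B', hA, hA', hB, hB', hAA, hBB, h1, h2, h3, h4, h5, h6, h7, h8⟩ := hF.2 _ hi
  have key : ∀ {X X' : Finset (Fin n)}, X ∈ insert {i} F → X' ∈ insert {i} F → X ⊂ X' →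
      X ∈ F ∨ X' ∈ F := by
    intro X X' hX hX' hlt
    rcases Finset.mem_insert.1 hX with e | h
    · exact Or.inr ((Finset.mem_insert.1 hX').resolve_left fun e' => hlt.ne (e.trans e'.symm))
    · exact Or.inl h
  rcases key hA hA' hAA with h | h <;> rcases key hB hB' hBB with h' | h'
  · exact ⟨_, h, _, h', h1, h2⟩
  · exact ⟨_, h, _, h', h3, h4⟩
  · exact ⟨_, h, _, h', h5, h6⟩
  · exact ⟨_, h, _, h', h7, h8⟩

end

/-- For every `n ≥ 2`, every induced-`2C₂`-saturated family `F ⊆ 𝒫([n])`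
has at least `n + 2` members. -/
theorem lower_bound_n_plus_two (n : ℕ) (hn : 2 ≤ n)
    (F : Finset (Finset (Fin n))) (hF : Saturated2C2 F) :
    n + 2 ≤ F.card := by
  choose A hA hiA hmax using hF.exists_last_avoiding
  let V : Fin n → Finset (Fin n) := fun i => insert i (unionBelow F (A i))
  have hVF : ∀ i, V i ∈ F := fun i => hF.insert_unionBelow_mem (hA i) (hmax i)
  have hle : ∀ {i j : Fin n}, ∀ B ∈ F, i ∈ unionBelow F B → j ∉ unionBelow F B →
      V i ⊆ unionBelow F (A j) := by
    intro i j B hB hi hj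
    have hAB : strictlyBelow F (A i) ⊆ strictlyBelow F B :=
      (strictlyBelow_total hF.1 (hA i) hB).resolve_right
        fun h => hiA i (unionBelow_mono h hi)
    exact (Finset.insert_subset hi (unionBelow_mono hAB)).trans (unionBelow_mono (hmax j B hB hj))
  have hVinj : Function.Injective V := by
    intro i j hij
    by_contra hne
    have hi : i ∈ unionBelow F (A j) :=
      (Finset.mem_insert.1 (hij ▸ Finset.mem_insert_self i _ : i ∈ V j)).resolve_left hne
    exact hiA j (hle _ (hA j) hi (hiA j) (hij ▸ Finset.mem_insert_self j _))
  have hempty : ∅ ∉ Finset.univ.image V := by simp [V]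
  have hcard : (insert ∅ (Finset.univ.image V)).card = n + 1 := by
    rw [Finset.card_insert_of_notMem hempty, Finset.card_image_of_injective _ hVinj]
    simp
  have hsub : insert ∅ (Finset.univ.image V) ⊆ F := by
    refine Finset.insert_subset hF.empty_mem fun X hX => ?_
    obtain ⟨i, -, rfl⟩ := Finset.mem_image.1 hX
    exact hVF i
  by_contra! hlt
  have hFeq := Finset.eq_of_subset_of_card_le hsub (by omega)
  have hform : ∀ X ∈ F, X.Nonempty → ∃ i, V i = X := by
    intro X hX hne
    rw [← hFeq, Finset.mem_insert] at hX
    simpa using hX.resolve_left hne.ne_empty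
  obtain ⟨X, hX, Y, hY, hXY, hYX⟩ := hF.exists_incomparable_s3 hn
  obtain ⟨i, rfl⟩ := hform X hX (Finset.nonempty_iff_ne_empty.2 fun e => hXY (by simp [e]))
  obtain ⟨j, rfl⟩ := hform Y hY (Finset.nonempty_iff_ne_empty.2 fun e => hYX (by simp [e]))
  have hiff : ∀ B ∈ F, (i ∈ unionBelow F B ↔ j ∈ unionBelow F B) := fun B hB =>
    ⟨fun hi => by_contra fun hj => hXY ((hle B hB hi hj).trans (Finset.subset_insert _ _)),
      fun hj => by_contra fun hi => hYX ((hle B hB hj hi).trans (Finset.subset_insert _ _))⟩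
  obtain ⟨T, hT, hiT, hmin, hTB⟩ := hF.exists_first_containing i
  have hjT : j ∈ T := by
    rcases hTB with rfl | ⟨B, hB, rfl⟩
    · exact Finset.mem_univ _
    · exact (hiff B hB).1 hiT
  obtain ⟨l, rfl⟩ := hform T hT ⟨i, hiT⟩
  have hil : i ∈ unionBelow F (A l) := by
    rcases Finset.mem_insert.1 hiT with e | h
    · rcases Finset.mem_insert.1 hjT with e' | h'
      · exact absurd (by rw [e, e']) hXY
      · exact (hiff _ (hA l)).2 h'
    · exact h
  exact hiA l (hmin _ (hA l) hil (Finset.mem_insert_self _ _))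
end

section
/- Every induced-2C2-saturated family F of subsets of [n] contains a maximal chain of the Boolean lattice: there exist sets D_0 ⊊ D_1 ⊊ ⋯ ⊊ D_n, all belonging to F, with |D_i| = i for every 0 ≤ i ≤ n. -/
/-- `Z` separates every strict pair `B ⊂ C` of `F`: it contains `B` or is contained in `C`. -/
def SeparatesPairs {n : ℕ} (F : Finset (Finset (Fin n))) (Z : Finset (Fin n)) : Prop :=
  ∀ B ∈ F, ∀ C ∈ F, B ⊂ C → B ⊆ Z ∨ Z ⊆ C

/-- A set separating all strict pairs of a saturated family belongs to that family. -/
theorem SeparatesPairs.mem {n : ℕ} {F : Finset (Finset (Fin n))} {Z : Finset (Fin n)}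
    (hZ : SeparatesPairs F Z) (hF : Saturated2C2 F) : Z ∈ F := by
  by_contra hmem
  obtain ⟨A, A', B, B', hA, hA', hB, hB', hAA, hBB, h1, h2, h3, h4, h5, h6, h7, h8⟩ :=
    hF.2 Z hmem
  rw [Finset.mem_insert] at hA hA' hB hB'
  have sepB : B ∈ F → B' ∈ F → B ⊆ Z ∨ Z ⊆ B' := fun h h' => hZ B h B' h' hBB
  have sepA : A ∈ F → A' ∈ F → A ⊆ Z ∨ Z ⊆ A' := fun h h' => hZ A h A' h' hAA
  have hfree : A ∈ F → A' ∈ F → B ∈ F → B' ∈ F → False := fun a a' b b' =>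
    hF.1 ⟨A, A', B, B', a, a', b, b', hAA, hBB, h1, h2, h3, h4, h5, h6, h7, h8⟩
  have hrefl : Z ⊆ Z := Finset.Subset.refl Z
  rcases hA with rfl | hA <;> rcases hA' with rfl | hA' <;>
    rcases hB with rfl | hB <;> rcases hB' with rfl | hB' <;> tauto

/-- In an induced-`2C₂`-free family the strict down-sets are totally ordered by inclusion. -/
theorem filter_ssubset_total {n : ℕ} {F : Finset (Finset (Fin n))} (hF : ¬ Contains2C2 F)
    {X Y : Finset (Fin n)} (hX : X ∈ F) (hY : Y ∈ F) :
    F.filter (· ⊂ X) ⊆ F.filter (· ⊂ Y) ∨ F.filter (· ⊂ Y) ⊆ F.filter (· ⊂ X) := by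
  by_contra! h
  obtain ⟨⟨A, hA, hA'⟩, B, hB, hB'⟩ := And.imp Finset.not_subset.1 Finset.not_subset.1 h
  simp only [Finset.mem_filter, not_and] at hA hA' hB hB'
  obtain ⟨hAF, hAX⟩ := hA
  obtain ⟨hBF, hBY⟩ := hB
  have hAY := hA' hAF
  have hBX := hB' hBF
  refine hF ⟨A, X, B, Y, hAF, hX, hBF, hY, hAX, hBY, fun h => hAY (h.trans_ssubset hBY),
    fun h => hBX (h.trans_ssubset hAX), fun h => ?_, fun h => hBX ((hBY.trans_subset h).trans hAX),
    fun h => hAY ((hAX.trans_subset h).trans hBY), fun h => ?_,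
    fun h => hAY (hAX.trans_subset h), fun h => hBX (hBY.trans_subset h)⟩
  · rcases h.eq_or_ssubset with rfl | h
    · exact hBX (hBY.trans hAX)
    · exact hAY h
  · rcases h.eq_or_ssubset with rfl | h
    · exact hAY (hAX.trans hBY)
    · exact hBX h

/-- A proper subset separating all strict pairs can be enlarged by one element. -/
theorem SeparatesPairs.exists_insert {n : ℕ} {F : Finset (Finset (Fin n))}
    {Z : Finset (Fin n)} (hZ : SeparatesPairs F Z) (hF : ¬ Contains2C2 F)
    (hne : Z ≠ Finset.univ) : ∃ e ∉ Z, SeparatesPairs F (insert e Z) := by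
  classical
  suffices h : ∃ e ∉ Z, ∀ B ∈ F, ∀ B' ∈ F, B ⊂ B' → ¬ B ⊆ Z → e ∈ B' by
    obtain ⟨e, he, hmem⟩ := h
    refine ⟨e, he, fun B hB B' hB' hBB => ?_⟩
    by_cases hBZ : B ⊆ Z
    · exact Or.inl (hBZ.trans (Finset.subset_insert e Z))
    · exact Or.inr (Finset.insert_subset (hmem B hB B' hB' hBB hBZ)
        ((hZ B hB B' hB' hBB).resolve_left hBZ))
  rcases (F.filter fun B' => ∃ B ∈ F, B ⊂ B' ∧ ¬ B ⊆ Z).eq_empty_or_nonempty with h | h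
  · obtain ⟨e, he⟩ : ∃ e, e ∉ Z := by
      simpa [Finset.eq_univ_iff_forall] using hne
    refine ⟨e, he, fun B hB B' hB' hBB hBZ => ?_⟩
    exact absurd ⟨B, hB, hBB, hBZ⟩ (Finset.filter_eq_empty_iff.1 h hB')
  · obtain ⟨M, hM, hmin⟩ :=
      Finset.exists_min_image _ (fun X : Finset (Fin n) => (F.filter fun Y => Y ⊂ X).card) h
    obtain ⟨hMF, L, hLF, hLM, hLZ⟩ := Finset.mem_filter.1 hM
    obtain ⟨e, heL, heZ⟩ := Finset.not_subset.1 hLZ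
    refine ⟨e, heZ, fun B hB B' hB' hBB hBZ => ?_⟩
    have hcard := hmin B' (Finset.mem_filter.2 ⟨hB', B, hB, hBB, hBZ⟩)
    have hsub : F.filter (· ⊂ M) ⊆ F.filter (· ⊂ B') := by
      rcases filter_ssubset_total hF hMF hB' with h | h
      · exact h
      · exact (Finset.eq_of_subset_of_card_le h hcard).ge
    exact (Finset.mem_filter.1 (hsub (Finset.mem_filter.2 ⟨hLF, hLM⟩))).2.subset heL

/-- Every induced-`2C₂`-saturated family contains a maximal chain of the
Boolean lattice: sets `D_0 ⊊ D_1 ⊊ ⋯ ⊊ D_n`, all in `F`, with `|D_i| = i`. -/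
theorem saturated_contains_maximal_chain (n : ℕ)
    (F : Finset (Finset (Fin n))) (hF : Saturated2C2 F) :
    ∃ D : ℕ → Finset (Fin n),
      (∀ i, i ≤ n → D i ∈ F ∧ (D i).card = i) ∧
      (∀ i, i < n → D i ⊂ D (i + 1)) := by
  have hstep : ∀ Z : Finset (Fin n), ∃ Z', SeparatesPairs F Z → Z.card < n →
      SeparatesPairs F Z' ∧ Z ⊂ Z' ∧ Z'.card = Z.card + 1 := by
    intro Z
    by_cases h : SeparatesPairs F Z ∧ Z.card < n
    · have hne : Z ≠ Finset.univ := by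
        rintro rfl
        simp at h
      obtain ⟨e, he, hsep⟩ := h.1.exists_insert hF.1 hne
      exact ⟨insert e Z, fun _ _ =>
        ⟨hsep, Finset.ssubset_insert he, Finset.card_insert_of_notMem he⟩⟩
    · exact ⟨Z, fun h1 h2 => absurd ⟨h1, h2⟩ h⟩
  choose f hf using hstep
  have hD : ∀ i, i ≤ n → SeparatesPairs F (f^[i] ∅) ∧ (f^[i] ∅).card = i := by
    intro i
    induction i with
    | zero => exact fun _ => ⟨fun _ _ B' _ _ => Or.inr (Finset.empty_subset B'), rfl⟩
    | succ i ih =>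
      intro hi
      obtain ⟨hsep, hcard⟩ := ih (by omega)
      obtain ⟨hsep', -, hcard'⟩ := hf _ hsep (by omega)
      rw [Function.iterate_succ_apply']
      exact ⟨hsep', by omega⟩
  refine ⟨fun i => f^[i] ∅, fun i hi => ⟨(hD i hi).1.mem hF, (hD i hi).2⟩, fun i hi => ?_⟩
  obtain ⟨hsep, hcard⟩ := hD i hi.le
  simp only [Function.iterate_succ_apply']
  exact (hf _ hsep (by omega)).2.1
end

section
/- For each integer n with 2 ≤ n ≤ 6, every induced-2C2-saturated family F of subsets of [n] satisfies |F| ≥ 2n; consequently sat*(n, 2C2) = 2n for these n. -/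
open Finset

/-! ### Sets splitting all comparable pairs -/

/-- `S` splits `F` if every comparable pair `A ⊂ B` of `F` has `A` below `S` or `B` above `S`. -/
def Splits2C2 {n : ℕ} (F : Finset (Finset (Fin n))) (S : Finset (Fin n)) : Prop :=
  ∀ A ∈ F, ∀ B ∈ F, A ⊂ B → A ⊆ S ∨ S ⊆ B

/-- A missing set of a saturated family is comparable to a member `T` of the family, and both are
incomparable to the members of some pair `B ⊂ B'` of the family. -/
theorem Saturated2C2.exists_of_notMem {n : ℕ} {F : Finset (Finset (Fin n))}
    (h : Saturated2C2 F) {S : Finset (Fin n)} (hS : S ∉ F) :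
    ∃ T ∈ F, ∃ B ∈ F, ∃ B' ∈ F, B ⊂ B' ∧ (S ⊂ T ∨ T ⊂ S) ∧
      ¬ S ⊆ B' ∧ ¬ B ⊆ S ∧ ¬ T ⊆ B' ∧ ¬ B ⊆ T := by
  obtain ⟨A, A', B, B', hA, hA', hB, hB', h1, h2, h3, h4, h5, h6, h7, h8, h9, h10⟩ := h.2 S hS
  have hfree := h.1
  simp only [mem_insert] at hA hA' hB hB'
  have n1 : A ≠ A' := h1.ne
  have n2 : B ≠ B' := h2.ne
  have n3 : A ≠ B := fun e => h3 e.subset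
  have n4 : A ≠ B' := fun e => h5 e.subset
  have n5 : A' ≠ B := fun e => h7 e.subset
  have n6 : A' ≠ B' := fun e => h9 e.subset
  rcases hA with rfl | hA
  · exact ⟨A', by grind, B, by grind, B', by grind, h2, .inl h1, h5, h4, h9, h8⟩
  rcases hA' with rfl | hA'
  · exact ⟨A, hA, B, by grind, B', by grind, h2, .inr h1, h9, h8, h5, h4⟩
  rcases hB with rfl | hB
  · exact ⟨B', by grind, A, hA, A', hA', h1, .inl h2, h8, h3, h10, h5⟩
  rcases hB' with rfl | hB'
  · exact ⟨B, hB, A, hA, A', hA', h1, .inr h2, h10, h5, h8, h3⟩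
  exact absurd ⟨A, A', B, B', hA, hA', hB, hB', h1, h2, h3, h4, h5, h6, h7, h8, h9, h10⟩ hfree

theorem Saturated2C2.mem_of_splits {n : ℕ} {F : Finset (Finset (Fin n))}
    (h : Saturated2C2 F) {S : Finset (Fin n)} (hS : Splits2C2 F S) : S ∈ F := by
  by_contra hSF
  obtain ⟨_, -, B, hB, B', hB', hlt, -, h1, h2, -⟩ := h.exists_of_notMem hSF
  exact (hS B hB B' hB' hlt).elim h2 h1

/-- In a `2C₂`-free family the strict down-sets of the members form a chain. -/
theorem filter_ssubset_subset_or_subset {n : ℕ} {F : Finset (Finset (Fin n))}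
    (h : ¬ Contains2C2 F) {A B : Finset (Fin n)} (hA : A ∈ F) (hB : B ∈ F) :
    F.filter (· ⊂ A) ⊆ F.filter (· ⊂ B) ∨ F.filter (· ⊂ B) ⊆ F.filter (· ⊂ A) := by
  by_contra! hcon
  obtain ⟨hab, hba⟩ := hcon
  obtain ⟨Z, hZ, hZ'⟩ := not_subset.1 hab
  obtain ⟨W, hW, hW'⟩ := not_subset.1 hba
  simp only [mem_filter, not_and] at hZ hZ' hW hW'
  have hZB := hZ' hZ.1
  have hWA := hW' hW.1
  refine h ⟨Z, A, W, B, hZ.1, hA, hW.1, hB, hZ.2, hW.2, fun e => hZB (e.trans_ssubset hW.2),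
    fun e => hWA (e.trans_ssubset hZ.2), fun e => ?_, fun e => hWA (hW.2.trans_subset (e.trans hZ.2.subset)),
    fun e => hZB (hZ.2.trans_subset (e.trans hW.2.subset)), fun e => ?_,
    fun e => hZB (hZ.2.trans_subset e), fun e => hWA (hW.2.trans_subset e)⟩
  · rcases e.eq_or_ssubset with rfl | e
    · exact hWA (hW.2.trans hZ.2)
    · exact hZB e
  · rcases e.eq_or_ssubset with rfl | e
    · exact hZB (hZ.2.trans hW.2)
    · exact hWA e

theorem Splits2C2.exists_insert {n : ℕ} {F : Finset (Finset (Fin n))} (h : ¬ Contains2C2 F)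
    {S : Finset (Fin n)} (hS : Splits2C2 F S) (hne : S ≠ univ) :
    ∃ i ∉ S, Splits2C2 F (insert i S) := by
  by_cases hP : (F.filter fun B' => ∃ B ∈ F, B ⊂ B' ∧ ¬ B ⊆ S).Nonempty
  · obtain ⟨A, hA, hmin⟩ := exists_min_image _ (fun B' : Finset (Fin n) => (F.filter (· ⊂ B')).card) hP
    obtain ⟨hAF, B, hBF, hBA, hBS⟩ := mem_filter.1 hA
    obtain ⟨i, hiB, hiS⟩ := not_subset.1 hBS
    refine ⟨i, hiS, fun C hC C' hC' hlt => or_iff_not_imp_left.2 fun hCS => ?_⟩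
    have hCS' : ¬ C ⊆ S := fun e => hCS (e.trans (subset_insert i S))
    have hdown : F.filter (· ⊂ A) ⊆ F.filter (· ⊂ C') := by
      rcases filter_ssubset_subset_or_subset h hAF hC' with e | e
      · exact e
      · exact (eq_of_subset_of_card_le e
          (hmin C' (mem_filter.2 ⟨hC', C, hC, hlt, hCS'⟩))).symm.subset
    have hBC' : B ⊂ C' := (mem_filter.1 (hdown (mem_filter.2 ⟨hBF, hBA⟩))).2
    exact insert_subset (hBC'.subset hiB) ((hS C hC C' hC' hlt).resolve_left hCS')
  · obtain ⟨i, hi⟩ : ∃ i, i ∉ S := by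
      by_contra! hall
      exact hne (eq_univ_iff_forall.2 hall)
    refine ⟨i, hi, fun C hC C' hC' hlt => .inl ?_⟩
    by_contra hCS
    exact hP ⟨C', mem_filter.2 ⟨hC', C, hC, hlt, fun e => hCS (e.trans (subset_insert i S))⟩⟩

/-- The first `t` elements of `Fin n` in the order given by `e`. -/
def initialSet {n : ℕ} (e : Fin n ≃ Fin n) (t : ℕ) : Finset (Fin n) :=
  univ.filter fun a => (e.symm a : ℕ) < t

theorem mem_initialSet {n : ℕ} {e : Fin n ≃ Fin n} {t : ℕ} {a : Fin n} :
    a ∈ initialSet e t ↔ (e.symm a : ℕ) < t := by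
  simp [initialSet]

theorem exists_equiv_splits {n : ℕ} {F : Finset (Finset (Fin n))} (h : ¬ Contains2C2 F) :
    ∃ e : Fin n ≃ Fin n, ∀ t ≤ n, Splits2C2 F (initialSet e t) := by
  have key : ∀ k ≤ n, ∃ x : Fin k → Fin n, Function.Injective x ∧
      ∀ t ≤ k, Splits2C2 F ((univ.filter fun j : Fin k => (j : ℕ) < t).image x) := by
    intro k
    induction k with
    | zero =>
      intro _
      refine ⟨Fin.elim0, fun a => a.elim0, fun t _ B _ B' _ _ => .inr ?_⟩
      simp
    | succ k ih =>
      intro hk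
      obtain ⟨x, hx, hsp⟩ := ih (by omega)
      have hfull : (univ.filter fun j : Fin k => (j : ℕ) < k) = univ := by
        ext j; simp
      have hne : univ.image x ≠ univ := by
        intro e
        have := congrArg card e
        rw [card_image_of_injective _ hx, card_univ, card_univ, Fintype.card_fin,
          Fintype.card_fin] at this
        omega
      obtain ⟨i, hi, hins⟩ := (hfull ▸ hsp k le_rfl : Splits2C2 F (univ.image x)).exists_insert h hne
      refine ⟨Fin.snoc x i, Fin.snoc_injective_iff.2 ⟨hx, by simpa using hi⟩, fun t ht => ?_⟩
      rcases Nat.lt_or_ge k t with hkt | hkt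
      · convert hins using 1
        ext a
        simp only [mem_image, mem_filter, mem_univ, true_and, mem_insert]
        rw [Fin.exists_fin_succ']
        simp only [Fin.snoc_castSucc, Fin.snoc_last, Fin.val_castSucc, Fin.val_last]
        grind
      · convert hsp t hkt using 1
        ext a
        simp only [mem_image, mem_filter, mem_univ, true_and]
        rw [Fin.exists_fin_succ']
        simp only [Fin.snoc_castSucc, Fin.snoc_last, Fin.val_castSucc, Fin.val_last]
        grind
  obtain ⟨x, hx, hsp⟩ := key n le_rfl
  refine ⟨Equiv.ofBijective x (Finite.injective_iff_bijective.1 hx), fun t ht => ?_⟩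
  convert hsp t ht using 1
  ext a
  simp only [mem_initialSet, mem_image, mem_filter, mem_univ, true_and]
  constructor
  · exact fun ha => ⟨_, ha, Equiv.ofBijective_apply_symm_apply x _ a⟩
  · rintro ⟨j, hj, rfl⟩
    rwa [Equiv.ofBijective_symm_apply_apply]

/-! ### Conflicts -/

/-- `A ⊆ B`, although `A` is not contained in an initial set contained in `B`. -/
def Conflict {n : ℕ} (e : Fin n ≃ Fin n) (A B : Finset (Fin n)) : Prop :=
  A ⊆ B ∧ ∃ i j, i ≤ j ∧ e j ∈ A ∧ e i ∉ B

theorem Conflict.self_left {n : ℕ} {e : Fin n ≃ Fin n} {A B : Finset (Fin n)}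
    (h : Conflict e A B) : Conflict e A A :=
  let ⟨hAB, i, j, hij, hj, hi⟩ := h
  ⟨Subset.rfl, i, j, hij, hj, fun hi' => hi (hAB hi')⟩

theorem Conflict.self_right {n : ℕ} {e : Fin n ≃ Fin n} {A B : Finset (Fin n)}
    (h : Conflict e A B) : Conflict e B B :=
  let ⟨hAB, i, j, hij, hj, hi⟩ := h
  ⟨Subset.rfl, i, j, hij, hAB hj, hi⟩

theorem not_conflict_initialSet {n : ℕ} (e : Fin n ≃ Fin n) (t : ℕ) :
    ¬ Conflict e (initialSet e t) (initialSet e t) := by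
  rintro ⟨-, i, j, hij, hj, hi⟩
  simp only [mem_initialSet, Equiv.symm_apply_apply] at hi hj
  have : (i : ℕ) ≤ j := hij
  omega

theorem not_conflict_of_ssubset {n : ℕ} {F : Finset (Finset (Fin n))} {e : Fin n ≃ Fin n}
    (he : ∀ t ≤ n, Splits2C2 F (initialSet e t)) {A B : Finset (Fin n)}
    (hA : A ∈ F) (hB : B ∈ F) (hAB : A ≠ B) : ¬ Conflict e A B := by
  rintro ⟨hsub, i, j, hij, hj, hi⟩
  rcases he j j.2.le A hA B hB (hsub.ssubset_of_ne hAB) with h | h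
  · simpa [mem_initialSet] using h hj
  · rcases hij.eq_or_lt with rfl | hlt
    · exact hi (hsub hj)
    · exact hi (h (by simpa [mem_initialSet] using hlt))

theorem conflict_of_incomparable {n : ℕ} {F : Finset (Finset (Fin n))} {e : Fin n ≃ Fin n}
    (he : ∀ t ≤ n, Splits2C2 F (initialSet e t)) {A A' B B' : Finset (Fin n)}
    (hA : A ⊆ A') (hB : B ∈ F) (hB' : B' ∈ F) (hlt : B ⊂ B')
    (h1 : ¬ A ⊆ B') (h2 : ¬ B ⊆ A') : Conflict e A A' := by
  refine ⟨hA, ?_⟩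
  by_contra! hcon
  obtain ⟨a, ha, -⟩ := not_subset.1 h1
  obtain ⟨j, hj, hmax⟩ := (univ.filter fun j => e j ∈ A).exists_max_image id
    ⟨e.symm a, by simpa using ha⟩
  simp only [mem_filter, mem_univ, true_and, id] at hj hmax
  rcases he (j + 1) j.2 B hB B' hB' hlt with h | h
  · refine h2 fun b hb => ?_
    have hbj := mem_initialSet.1 (h hb)
    have := hcon (e.symm b) j (Fin.le_def.2 (by omega)) hj
    simpa using this
  · refine h1 fun b hb => h (mem_initialSet.2 ?_)
    have := Fin.le_def.1 (hmax (e.symm b) (by simpa using hb))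
    omega

theorem Saturated2C2.exists_conflict {n : ℕ} {F : Finset (Finset (Fin n))} (h : Saturated2C2 F)
    {e : Fin n ≃ Fin n} (he : ∀ t ≤ n, Splits2C2 F (initialSet e t)) {S : Finset (Fin n)}
    (hS : Conflict e S S) : ∃ T ∈ F, Conflict e T T ∧ (Conflict e S T ∨ Conflict e T S) := by
  by_cases hSF : S ∈ F
  · exact ⟨S, hSF, hS, .inl hS⟩
  · obtain ⟨T, hT, B, hB, B', hB', hlt, hST | hST, h1, h2, h3, h4⟩ := h.exists_of_notMem hSF
    · have := conflict_of_incomparable he hST.subset hB hB' hlt h1 h4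
      exact ⟨T, hT, this.self_right, .inl this⟩
    · have := conflict_of_incomparable he hST.subset hB hB' hlt h3 h2
      exact ⟨T, hT, this.self_left, .inr this⟩

/-! ### Encoding sets as bit masks -/

/-- The conflict relation on bit masks. -/
def maskConflict (a b : ℕ) : Bool :=
  Nat.beq (a &&& b) a && !Nat.beq ((2 ^ (2 * a).log2 - 1) &&& b) (2 ^ (2 * a).log2 - 1)

/-- The symmetrized conflict relation on bit masks. -/
def maskRel (a b : ℕ) : Bool := maskConflict a b || maskConflict b a

/-- The bit mask of a set, read in the order given by `e`. -/
def maskOf {n : ℕ} (e : Fin n ≃ Fin n) (A : Finset (Fin n)) : ℕ :=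
  Nat.ofBits fun r : Fin n => decide (e r ∈ A)

theorem testBit_maskOf {n : ℕ} (e : Fin n ≃ Fin n) (A : Finset (Fin n)) (i : ℕ) :
    (maskOf e A).testBit i = true ↔ ∃ h : i < n, e ⟨i, h⟩ ∈ A := by
  by_cases h : i < n
  · simp [maskOf, Nat.testBit_ofBits_lt _ _ h, h]
  · simp [maskOf, Nat.testBit_ofBits_ge _ _ (not_lt.1 h), h]

theorem maskOf_injective {n : ℕ} (e : Fin n ≃ Fin n) : Function.Injective (maskOf e) := by
  intro A B h
  ext a
  have h1 := testBit_maskOf e A (e.symm a)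
  rw [h, testBit_maskOf] at h1
  simpa using h1.symm

theorem exists_maskOf_eq {n : ℕ} (e : Fin n ≃ Fin n) {s : ℕ} (hs : s < 2 ^ n) :
    ∃ S, maskOf e S = s := by
  refine ⟨univ.filter fun a => s.testBit (e.symm a), Nat.eq_of_testBit_eq fun i => ?_⟩
  rw [Bool.eq_iff_iff, testBit_maskOf]
  constructor
  · rintro ⟨h, hi⟩
    simpa using hi
  · intro hi
    have h : i < n := by
      by_contra hn
      rw [Nat.testBit_lt_two_pow (hs.trans_le (Nat.pow_le_pow_right two_pos (not_lt.1 hn)))] at hi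
      exact absurd hi (by simp)
    exact ⟨h, by simpa using hi⟩

theorem and_eq_left_iff_testBit (a b : ℕ) :
    a &&& b = a ↔ ∀ i, a.testBit i = true → b.testBit i = true := by
  constructor
  · intro h i hi
    rw [← h, Nat.testBit_and, Bool.and_eq_true] at hi
    exact hi.2
  · intro h
    refine Nat.eq_of_testBit_eq fun i => ?_
    rw [Nat.testBit_and]
    cases hi : a.testBit i
    · rfl
    · simp [h i hi]

theorem lt_log2_two_mul_iff (a i : ℕ) :
    i < (2 * a).log2 ↔ ∃ j, i ≤ j ∧ a.testBit j = true := by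
  rcases eq_or_ne a 0 with rfl | ha
  · simp
  · rw [← Nat.succ_le_iff, Nat.le_log2 (by omega), Nat.pow_succ', Nat.mul_le_mul_left_iff two_pos]
    exact ⟨Nat.exists_ge_and_testBit_of_ge_two_pow, fun ⟨j, hij, hj⟩ =>
      (Nat.pow_le_pow_right two_pos hij).trans (Nat.ge_two_pow_of_testBit hj)⟩

theorem maskConflict_iff (a b : ℕ) : maskConflict a b = true ↔
    (∀ i, a.testBit i = true → b.testBit i = true) ∧
      ∃ i j, i ≤ j ∧ a.testBit j = true ∧ b.testBit i = false := by
  rw [maskConflict, Bool.and_eq_true, Bool.not_eq_true', ← Bool.not_eq_true, Nat.beq_eq, Nat.beq_eq,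
    and_eq_left_iff_testBit, and_eq_left_iff_testBit]
  simp only [Nat.testBit_two_pow_sub_one, decide_eq_true_eq, lt_log2_two_mul_iff,
    not_forall, exists_prop, Bool.not_eq_true]
  exact and_congr_right fun _ => ⟨fun ⟨i, ⟨j, hij, hj⟩, hi⟩ => ⟨i, j, hij, hj, hi⟩,
    fun ⟨i, j, hij, hj, hi⟩ => ⟨i, ⟨j, hij, hj⟩, hi⟩⟩

theorem maskConflict_maskOf {n : ℕ} (e : Fin n ≃ Fin n) (A B : Finset (Fin n)) :
    maskConflict (maskOf e A) (maskOf e B) = true ↔ Conflict e A B := by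
  simp only [maskConflict_iff, ← Bool.not_eq_true, testBit_maskOf, Conflict]
  refine and_congr ⟨fun h a ha => ?_, fun h i ⟨hi, hA⟩ => ⟨hi, h hA⟩⟩ ⟨?_, ?_⟩
  · obtain ⟨_, hb⟩ := h (e.symm a) ⟨(e.symm a).2, by simpa using ha⟩
    simpa using hb
  · rintro ⟨i, j, hij, ⟨hj, hA⟩, hB⟩
    exact ⟨⟨i, by omega⟩, ⟨j, hj⟩, hij, hA, fun h => hB ⟨_, h⟩⟩
  · rintro ⟨i, j, hij, hA, hB⟩
    exact ⟨i, j, hij, ⟨j.2, hA⟩, fun ⟨_, h⟩ => hB h⟩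

theorem maskRel_maskOf {n : ℕ} (e : Fin n ≃ Fin n) (A B : Finset (Fin n)) :
    maskRel (maskOf e A) (maskOf e B) = true ↔ Conflict e A B ∨ Conflict e B A := by
  simp only [maskRel, Bool.or_eq_true, maskConflict_maskOf]

/-! ### Independent dominating sets of masks -/

/-- Search certifying that the list `E` cannot be extended by at most `k` pairwise unrelated masks
below `2 ^ n` so that every mask in `hints` is related to some mask of the result. -/
def noSmallDominating (n : ℕ) (hints : List ℕ) : ℕ → List ℕ → Bool
  | k, E =>
    match hints.find? (fun s => !E.any (maskRel s)) with
    | none => false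
    | some s =>
      match k with
      | 0 => true
      | k + 1 => (List.range (2 ^ n)).all fun t =>
          !maskRel s t || (E.any (maskRel t) || noSmallDominating n hints k (t :: E))

theorem lt_card_of_noSmallDominating {n : ℕ} {hints : List ℕ} {k : ℕ} {E : List ℕ}
    (hsearch : noSmallDominating n hints k E = true) (R : Finset ℕ)
    (hlt : ∀ t ∈ R, t < 2 ^ n)
    (hindep : ∀ s ∈ R, ∀ t ∈ R, s ≠ t → maskRel s t = false)
    (hE : ∀ t ∈ R, E.any (maskRel t) = false)
    (hdom : ∀ s ∈ hints, E.any (maskRel s) = true ∨ ∃ t ∈ R, maskRel s t = true) :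
    k < R.card := by
  induction k generalizing E R with
  | zero =>
    rw [noSmallDominating] at hsearch
    split at hsearch
    · simp at hsearch
    · rename_i s hs
      have hs' := List.find?_some hs
      obtain ⟨t, ht, -⟩ := (hdom s (List.mem_of_find?_eq_some hs)).resolve_left (by simpa using hs')
      exact card_pos.2 ⟨t, ht⟩
  | succ k ih =>
    rw [noSmallDominating] at hsearch
    split at hsearch
    · simp at hsearch
    · rename_i s hs
      have hs' := List.find?_some hs
      obtain ⟨t, ht, hst⟩ :=
        (hdom s (List.mem_of_find?_eq_some hs)).resolve_left (by simpa using hs')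
      have hall := List.all_eq_true.1 hsearch t (List.mem_range.2 (hlt t ht))
      rw [hst, hE t ht] at hall
      have := ih (by simpa using hall) (R.erase t) (fun u hu => hlt u (mem_of_mem_erase hu))
        (fun u hu v hv => hindep u (mem_of_mem_erase hu) v (mem_of_mem_erase hv))
        (fun u hu => by
          rw [List.any_cons, hE u (mem_of_mem_erase hu),
            hindep u (mem_of_mem_erase hu) t ht (ne_of_mem_erase hu)]
          rfl)
        (fun u hu => by
          rw [List.any_cons]
          rcases hdom u hu with h | ⟨v, hv, huv⟩
          · exact .inl (by simp [h])
          · by_cases hvt : v = t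
            · exact .inl (by simp [← hvt, huv])
            · exact .inr ⟨v, mem_erase.2 ⟨hvt, hv⟩, huv⟩)
      rw [card_erase_of_mem ht] at this
      omega

theorem Saturated2C2.lt_card_of_noSmallDominating {n : ℕ} {F : Finset (Finset (Fin n))}
    (h : Saturated2C2 F) {k : ℕ} (hints : List ℕ)
    (hhints : hints.all (fun s => Nat.blt s (2 ^ n) && maskRel s s) = true)
    (hsearch : noSmallDominating n hints k [] = true) : n + 1 + k < F.card := by
  classical
  obtain ⟨e, he⟩ := exists_equiv_splits h.1
  have hR : k < ((F.filter fun A => Conflict e A A).image (maskOf e)).card := by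
    refine _root_.lt_card_of_noSmallDominating hsearch _ ?_ ?_ (by simp) ?_
    · intro t ht
      obtain ⟨A, -, rfl⟩ := mem_image.1 ht
      exact Nat.ofBits_lt_two_pow _
    · intro s hs t ht hst
      obtain ⟨A, hA, rfl⟩ := mem_image.1 hs
      obtain ⟨B, hB, rfl⟩ := mem_image.1 ht
      have hAB : A ≠ B := fun e => hst (by rw [e])
      rw [← Bool.not_eq_true, maskRel_maskOf, not_or]
      exact ⟨not_conflict_of_ssubset he (mem_filter.1 hA).1 (mem_filter.1 hB).1 hAB,
        not_conflict_of_ssubset he (mem_filter.1 hB).1 (mem_filter.1 hA).1 hAB.symm⟩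
    · intro s hs
      have hs' := List.all_eq_true.1 hhints s hs
      rw [Bool.and_eq_true, Nat.blt_eq] at hs'
      obtain ⟨S, rfl⟩ := exists_maskOf_eq e hs'.1
      obtain ⟨T, hT, hTT, hST⟩ := h.exists_conflict he (or_self_iff.1 ((maskRel_maskOf e S S).1 hs'.2))
      exact .inr ⟨_, mem_image_of_mem _ (mem_filter.2 ⟨hT, hTT⟩), (maskRel_maskOf e S T).2 hST⟩
  rw [card_image_of_injective _ (maskOf_injective e)] at hR
  have hchain : n + 1 ≤ (F.filter fun A => ¬ Conflict e A A).card := by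
    rw [← card_range (n + 1)]
    refine card_le_card_of_injOn (initialSet e) (fun t ht => ?_) fun s hs t ht hst => ?_
    · have ht' : t ≤ n := by simpa [Nat.lt_succ_iff] using ht
      exact mem_coe.2 (mem_filter.2 ⟨h.mem_of_splits (he t ht'), not_conflict_initialSet e t⟩)
    · have hs' : s ≤ n := by simpa [Nat.lt_succ_iff] using hs
      have ht' : t ≤ n := by simpa [Nat.lt_succ_iff] using ht
      by_contra hne
      rcases Nat.lt_or_gt_of_ne hne with hlt | hlt
      · have : e ⟨s, by omega⟩ ∈ initialSet e s := hst ▸ mem_initialSet.2 (by simpa using hlt)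
        simp [mem_initialSet] at this
      · have : e ⟨t, by omega⟩ ∈ initialSet e t := hst ▸ mem_initialSet.2 (by simpa using hlt)
        simp [mem_initialSet] at this
  have := card_filter_add_card_filter_not (s := F) (fun A => Conflict e A A)
  omega

/-! ### A saturated family with `2n` members -/

/-- All initial segments of `Fin n` together with all singletons. -/
def segmentsAndSingletons (n : ℕ) : Finset (Finset (Fin n)) :=
  ((range (n + 1)).image fun t => univ.filter fun a : Fin n => (a : ℕ) < t) ∪ univ.image singleton

theorem mem_segmentsAndSingletons {n : ℕ} {A : Finset (Fin n)} :
    A ∈ segmentsAndSingletons n ↔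
      (∃ t ≤ n, A = univ.filter fun a : Fin n => (a : ℕ) < t) ∨ ∃ a, A = {a} := by
  simp [segmentsAndSingletons, eq_comm]

theorem segment_mem_segmentsAndSingletons {n t : ℕ} (ht : t ≤ n) :
    (univ.filter fun a : Fin n => (a : ℕ) < t) ∈ segmentsAndSingletons n :=
  mem_segmentsAndSingletons.2 (.inl ⟨t, ht, rfl⟩)

theorem singleton_mem_segmentsAndSingletons {n : ℕ} (a : Fin n) :
    {a} ∈ segmentsAndSingletons n :=
  mem_segmentsAndSingletons.2 (.inr ⟨a, rfl⟩)

theorem saturated2C2_segmentsAndSingletons (n : ℕ) : Saturated2C2 (segmentsAndSingletons n) := by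
  constructor
  · rintro ⟨A, A', B, B', hA, hA', hB, hB', h1, h2, h3, h4, h5, h6, h7, h8, h9, h10⟩
    rcases mem_segmentsAndSingletons.1 hA' with ⟨s, hs, rfl⟩ | ⟨a, rfl⟩
    · rcases mem_segmentsAndSingletons.1 hB' with ⟨t, ht, rfl⟩ | ⟨b, rfl⟩
      · rcases le_total s t with hst | hst
        · exact h9 (monotone_filter_right _ fun x _ hx => lt_of_lt_of_le hx hst)
        · exact h10 (monotone_filter_right _ fun x _ hx => lt_of_lt_of_le hx hst)
      · rw [ssubset_singleton_iff] at h2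
        exact h4 (h2 ▸ empty_subset _)
    · rw [ssubset_singleton_iff] at h1
      exact h3 (h1 ▸ empty_subset _)
  · intro S hS
    have hne : S.Nonempty := by
      rw [nonempty_iff_ne_empty]
      rintro rfl
      exact hS (by simpa using segment_mem_segmentsAndSingletons (n := n) (Nat.zero_le n))
    obtain ⟨M, hM, hmax⟩ := S.exists_max_image id hne
    simp only [id, Fin.le_def] at hmax
    obtain ⟨m, hmS, hmM⟩ : ∃ m ∉ S, m < M := by
      by_contra! hcon
      refine hS ?_
      convert segment_mem_segmentsAndSingletons (n := n) (t := M + 1) M.2 using 1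
      ext a
      simp only [mem_filter, mem_univ, true_and, Nat.lt_succ_iff]
      refine ⟨hmax a, fun ha => ?_⟩
      by_contra haS
      have := Fin.le_def.1 (hcon a haS)
      exact haS (Fin.ext (le_antisymm ha this) ▸ hM)
    obtain ⟨b, hbS, hbM⟩ : ∃ b ∈ S, b < M := by
      by_contra! hcon
      refine hS ?_
      convert singleton_mem_segmentsAndSingletons M using 1
      ext a
      rw [mem_singleton]
      exact ⟨fun ha => Fin.ext (le_antisymm (hmax a ha) (Fin.le_def.1 (hcon a ha))), fun ha => ha ▸ hM⟩
    have hMseg : M ∉ univ.filter fun a : Fin n => (a : ℕ) < M := by simp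
    have hmseg : m ∈ univ.filter fun a : Fin n => (a : ℕ) < M := by simpa using hmM
    have hbseg : b ∈ univ.filter fun a : Fin n => (a : ℕ) < M := by simpa using hbM
    refine ⟨{M}, S, {m}, univ.filter fun a : Fin n => (a : ℕ) < M,
      mem_insert_of_mem (singleton_mem_segmentsAndSingletons M), mem_insert_self _ _,
      mem_insert_of_mem (singleton_mem_segmentsAndSingletons m),
      mem_insert_of_mem (segment_mem_segmentsAndSingletons M.2.le), ?_, ?_, ?_⟩
    · exact (ssubset_iff_of_subset (singleton_subset_iff.2 hM)).2
        ⟨b, hbS, by simpa using hbM.ne⟩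
    · exact (ssubset_iff_of_subset (singleton_subset_iff.2 hmseg)).2
        ⟨b, hbseg, by rw [mem_singleton]; rintro rfl; exact hmS hbS⟩
    · refine ⟨by simpa using hmM.ne', by simpa using hmM.ne,
        fun h => hMseg (h (mem_singleton_self M)), fun h => ?_, fun h => ?_,
        fun h => hmS (h (mem_singleton_self m)), fun h => hMseg (h hM), fun h => hmS (h hmseg)⟩
      · exact hmM.ne (mem_singleton.1 (h hmseg))
      · exact hmM.ne' (mem_singleton.1 (h hM))

/-- For `2 ≤ n ≤ 6`, every induced-`2C₂`-saturated family in `𝒫([n])` has at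
least `2n` members; consequently `sat*(n, 2C₂) = 2n` for these `n`. -/
theorem sat_small_n (n : ℕ) (hn2 : 2 ≤ n) (hn6 : n ≤ 6) :
    (∀ F : Finset (Finset (Fin n)), Saturated2C2 F → 2 * n ≤ F.card) ∧
    (∃ F : Finset (Finset (Fin n)), Saturated2C2 F ∧ F.card = 2 * n) := by
  refine ⟨fun F hF => ?_, segmentsAndSingletons n, saturated2C2_segmentsAndSingletons n, ?_⟩
  · suffices n + 1 + (n - 2) < F.card by omega
    interval_cases n
    · exact hF.lt_card_of_noSmallDominating [2] (by decide +kernel) (by decide +kernel)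
    · exact hF.lt_card_of_noSmallDominating [2, 5] (by decide +kernel) (by decide +kernel)
    · exact hF.lt_card_of_noSmallDominating [5, 9, 11, 6, 2]
        (by decide +kernel) (by decide +kernel)
    · exact hF.lt_card_of_noSmallDominating [5, 13, 11, 14, 9, 6, 2, 23, 17, 19]
        (by decide +kernel) (by decide +kernel)
    · exact hF.lt_card_of_noSmallDominating
        [5, 13, 11, 9, 25, 27, 29, 21, 19, 17, 23, 28, 18, 22, 30, 10, 14, 6, 2, 39, 47, 33, 56, 35]
        (by decide +kernel) (by decide +kernel)
  · interval_cases n <;> decide +kernel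
end
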